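/- Fix a generator x_i·y_j·z_k of M_Diag(n) (so 1 ≤ i < j < k ≤ n). Then the colon ideal (⟨ x_a·y_b·z_c : 1 ≤ a < b < c ≤ n and (a,b,c) lexicographically precedes (i,j,k) ⟩ : ⟨x_i·y_j·z_k⟩) equals the ideal generated by the variables {x_1,…,x_{i−1}} ∪ {y_{i+1},…,y_{j−1}} ∪ {z_{j+1},…,z_{k−1}}; in particular, this generating set of variables has exactly k − 3 elements. -/

import Mathlib

open MvPolynomial

/-- The monomial `x_i·y_j·z_k` attached to an index triple `(i,j,k)`.
Variables: `(0, i) ↦ x_i`, `(1, j) ↦ y_j`, `(2, k) ↦ z_k`. -/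
noncomputable def genMon (K : Type*) [Field K] (p : ℕ × ℕ × ℕ) :
    MvPolynomial (Fin 3 × ℕ) K :=
  MvPolynomial.X ((0 : Fin 3), p.1) * MvPolynomial.X ((1 : Fin 3), p.2.1) *
    MvPolynomial.X ((2 : Fin 3), p.2.2)

/-- Lexicographic order on index triples. -/
def lexLt (p q : ℕ × ℕ × ℕ) : Prop :=
  p.1 < q.1 ∨ (p.1 = q.1 ∧ (p.2.1 < q.2.1 ∨ (p.2.1 = q.2.1 ∧ p.2.2 < q.2.2)))

/-- The exponent vector of the monomial `x_i·y_j·z_k`. -/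
noncomputable def genExp (p : ℕ × ℕ × ℕ) : Fin 3 × ℕ →₀ ℕ :=
  Finsupp.single (0, p.1) 1 + Finsupp.single (1, p.2.1) 1 + Finsupp.single (2, p.2.2) 1

theorem genMon_eq_monomial (K : Type*) [Field K] (p : ℕ × ℕ × ℕ) :
    genMon K p = monomial (genExp p) 1 := by
  simp [genMon, genExp, X, monomial_mul]

theorem genExp_apply (p : ℕ × ℕ × ℕ) (v : Fin 3 × ℕ) :
    genExp p v = (if (0, p.1) = v then 1 else 0) + (if (1, p.2.1) = v then 1 else 0) +
      (if (2, p.2.2) = v then 1 else 0) := by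
  simp [genExp, Finsupp.single_apply]

/-- If `x_a·y_b·z_c` divides `m·x_i·y_j·z_k` and a coordinate of `(a, b, c)` differs from that of
`(i, j, k)`, then the corresponding variable divides `m`. -/
theorem ne_zero_of_genExp_le {p q : ℕ × ℕ × ℕ} {m : Fin 3 × ℕ →₀ ℕ}
    (h : genExp p ≤ m + genExp q) :
    (p.1 ≠ q.1 → m (0, p.1) ≠ 0) ∧ (p.2.1 ≠ q.2.1 → m (1, p.2.1) ≠ 0) ∧
      (p.2.2 ≠ q.2.2 → m (2, p.2.2) ≠ 0) := by
  refine ⟨fun hne => ?_, fun hne => ?_, fun hne => ?_⟩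
  · have := h (0, p.1)
    simp [genExp_apply, hne.symm] at this
    omega
  · have := h (1, p.2.1)
    simp [genExp_apply, hne.symm] at this
    omega
  · have := h (2, p.2.2)
    simp [genExp_apply, hne.symm] at this
    omega

/-- For a generator `x_i·y_j·z_k` of `M_Diag(n)` (with `1 ≤ i < j < k ≤ n`), the colon
ideal of the ideal generated by the lexicographically earlier generators by
`⟨x_i·y_j·z_k⟩` equals the ideal generated by the variables
`{x_1,…,x_{i−1}} ∪ {y_{i+1},…,y_{j−1}} ∪ {z_{j+1},…,z_{k−1}}`, and this set of variables
has exactly `k − 3` elements. -/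
theorem diag_matching_field_colon_ideal (K : Type*) [Field K]
    (n i j k : ℕ) (hn : 3 ≤ n) (h1 : 1 ≤ i) (hij : i < j) (hjk : j < k) (hkn : k ≤ n) :
    Submodule.colon
      (Ideal.span {f | ∃ p : ℕ × ℕ × ℕ,
        1 ≤ p.1 ∧ p.1 < p.2.1 ∧ p.2.1 < p.2.2 ∧ p.2.2 ≤ n ∧ lexLt p (i, j, k) ∧
        f = genMon K p})
      (Ideal.span {genMon K (i, j, k)}) =
    Ideal.span
      (((fun t => MvPolynomial.X ((0 : Fin 3), t)) '' Set.Icc 1 (i - 1)) ∪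
       ((fun t => MvPolynomial.X ((1 : Fin 3), t)) '' Set.Icc (i + 1) (j - 1)) ∪
       ((fun t => MvPolynomial.X ((2 : Fin 3), t)) '' Set.Icc (j + 1) (k - 1))) ∧
    (((fun t => (MvPolynomial.X ((0 : Fin 3), t) : MvPolynomial (Fin 3 × ℕ) K)) ''
        Set.Icc 1 (i - 1)) ∪
     ((fun t => MvPolynomial.X ((1 : Fin 3), t)) '' Set.Icc (i + 1) (j - 1)) ∪
     ((fun t => MvPolynomial.X ((2 : Fin 3), t)) '' Set.Icc (j + 1) (k - 1))).ncard
      = k - 3 := by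
  constructor
  · have hX : ((fun t => (X ((0 : Fin 3), t) : MvPolynomial (Fin 3 × ℕ) K)) ''
          Set.Icc 1 (i - 1)) ∪
        ((fun t => X ((1 : Fin 3), t)) '' Set.Icc (i + 1) (j - 1)) ∪
        ((fun t => X ((2 : Fin 3), t)) '' Set.Icc (j + 1) (k - 1)) =
        X '' ((Prod.mk 0 '' Set.Icc 1 (i - 1)) ∪ (Prod.mk 1 '' Set.Icc (i + 1) (j - 1)) ∪
          (Prod.mk 2 '' Set.Icc (j + 1) (k - 1))) := by
      simp only [Set.image_union, Set.image_image]
    apply le_antisymm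
    · intro f hf
      rw [Submodule.mem_colon] at hf
      have hfg := hf _ (Ideal.mem_span_singleton_self _)
      have hS : {f | ∃ p : ℕ × ℕ × ℕ, 1 ≤ p.1 ∧ p.1 < p.2.1 ∧ p.2.1 < p.2.2 ∧ p.2.2 ≤ n ∧
            lexLt p (i, j, k) ∧ f = genMon K p} =
          (fun s => monomial s (1 : K)) '' (genExp '' {p : ℕ × ℕ × ℕ | 1 ≤ p.1 ∧ p.1 < p.2.1 ∧
            p.2.1 < p.2.2 ∧ p.2.2 ≤ n ∧ lexLt p (i, j, k)}) := by
        ext f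
        constructor
        · rintro ⟨p, h1, h2, h3, h4, h5, rfl⟩
          exact ⟨_, ⟨p, ⟨h1, h2, h3, h4, h5⟩, rfl⟩, (genMon_eq_monomial K p).symm⟩
        · rintro ⟨_, ⟨p, ⟨h1, h2, h3, h4, h5⟩, rfl⟩, rfl⟩
          exact ⟨p, h1, h2, h3, h4, h5, (genMon_eq_monomial K p).symm⟩
      rw [hS, smul_eq_mul, genMon_eq_monomial, mem_ideal_span_monomial_image] at hfg
      rw [hX, mem_ideal_span_X_image]
      intro m hm
      obtain ⟨_, ⟨⟨a, b, c⟩, ⟨ha, hab, hbc, hc, hlt⟩, rfl⟩, hle⟩ := hfg (m + genExp (i, j, k)) (by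
        rw [mem_support_iff, coeff_mul_monomial, mul_one]
        exact mem_support_iff.mp hm)
      obtain ⟨hx, hy, hz⟩ := ne_zero_of_genExp_le hle
      simp only [lexLt] at ha hab hbc hc hlt hx hy hz
      rcases hlt with h | ⟨rfl, h | ⟨rfl, h⟩⟩
      · exact ⟨(0, a), .inl (.inl ⟨a, ⟨ha, by omega⟩, rfl⟩), hx h.ne⟩
      · exact ⟨(1, b), .inl (.inr ⟨b, ⟨hab, by omega⟩, rfl⟩), hy h.ne⟩
      · exact ⟨(2, c), .inr ⟨c, ⟨hbc, by omega⟩, rfl⟩, hz h.ne⟩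
    · rw [Ideal.span_le]
      rintro _ ((⟨t, ⟨ht1, ht2⟩, rfl⟩ | ⟨t, ⟨ht1, ht2⟩, rfl⟩) | ⟨t, ⟨ht1, ht2⟩, rfl⟩) <;>
        rw [SetLike.mem_coe, Ideal.mem_colon_span_singleton]
      · have : X (0, t) * genMon K (i, j, k) = X (0, i) * genMon K (t, j, k) := by
          simp only [genMon]; ring
        rw [this]
        exact Ideal.mul_mem_left _ _ (Ideal.subset_span
          ⟨(t, j, k), ht1, by grind, hjk, hkn, by grind [lexLt], rfl⟩)
      · have : X (1, t) * genMon K (i, j, k) = X (1, j) * genMon K (i, t, k) := by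
          simp only [genMon]; ring
        rw [this]
        exact Ideal.mul_mem_left _ _ (Ideal.subset_span
          ⟨(i, t, k), h1, ht1, by grind, hkn, by grind [lexLt], rfl⟩)
      · have : X (2, t) * genMon K (i, j, k) = X (2, k) * genMon K (i, j, t) := by
          simp only [genMon]; ring
        rw [this]
        exact Ideal.mul_mem_left _ _ (Ideal.subset_span
          ⟨(i, j, t), h1, hij, ht1, by grind, by grind [lexLt], rfl⟩)
  · have hinj (v : Fin 3) :
        Function.Injective fun t : ℕ => (X (v, t) : MvPolynomial (Fin 3 × ℕ) K) :=
      fun s t h => (Prod.mk.inj (X_injective h)).2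
    have hdisj {v w : Fin 3} (hvw : v ≠ w) (A B : Set ℕ) :
        Disjoint ((fun t => (X (v, t) : MvPolynomial (Fin 3 × ℕ) K)) '' A)
          ((fun t => X (w, t)) '' B) := by
      rw [Set.disjoint_left]
      rintro _ ⟨s, -, rfl⟩ ⟨t, -, h⟩
      exact hvw (Prod.mk.inj (X_injective h)).1.symm
    have hfin (v : Fin 3) (a b : ℕ) :
        ((fun t => (X (v, t) : MvPolynomial (Fin 3 × ℕ) K)) '' Set.Icc a b).Finite :=
      (Set.finite_Icc a b).image _
    have hcard (a b : ℕ) : (Set.Icc a b).ncard = b + 1 - a := by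
      rw [← Finset.coe_Icc, Set.ncard_coe_finset, Nat.card_Icc]
    rw [Set.ncard_union_eq (Set.disjoint_union_left.mpr
        ⟨hdisj (by decide) _ _, hdisj (by decide) _ _⟩) ((hfin _ _ _).union (hfin _ _ _))
        (hfin _ _ _),
      Set.ncard_union_eq (hdisj (by decide) _ _) (hfin _ _ _) (hfin _ _ _),
      Set.ncard_image_of_injective _ (hinj 0), Set.ncard_image_of_injective _ (hinj 1),
      Set.ncard_image_of_injective _ (hinj 2), hcard, hcard, hcard]
    omega
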